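/- arXiv:2509.17502 — 5 statements merged into one kernel-verified Lean document; each statement's English description precedes it below -/
import Mathlib

section
/- Let l ≥ 2 be an integer. Then every finite simple graph G with exactly m edges contains at most ((2l+1)^{l−1/2} / (2·(l−1)^{(l−1)(2l+1)/(2l)})) · (m/(2l+1))^{(2l+1)/2} induced copies of the cycle C_{2l+1} on 2l+1 vertices. -/
open SimpleGraph

/-- Number of induced copies of `H` in `G`: vertex subsets of `G` whose induced
subgraph is isomorphic to `H`. -/
noncomputable def inducedCopies {V W : Type*} [Fintype V] [Fintype W]
    (G : SimpleGraph V) (H : SimpleGraph W) : ℕ :=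
  {S : Finset V | Nonempty ((G.induce (S : Set V)) ≃g H)}.ncard

/-- The fractional independence number of a finite simple graph `H`. -/
noncomputable def fracIndepNum {V : Type*} [Fintype V] (H : SimpleGraph V) : ℝ :=
  sSup {x : ℝ | ∃ ω : V → ℝ, (∀ v, 0 ≤ ω v ∧ ω v ≤ 1) ∧
    (∀ u v, H.Adj u v → ω u + ω v ≤ 1) ∧ x = ∑ v, ω v}

/-- The set of vertices adjacent to at least one vertex of `S`. -/
def finNbhd {V : Type*} [Fintype V] (H : SimpleGraph V) [DecidableRel H.Adj]
    (S : Finset V) : Finset V :=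
  Finset.univ.filter (fun v => ∃ u ∈ S, H.Adj u v)

/-- Generalized Hölder inequality for finite sums, in power form. -/
theorem sum_pow_card_le_mul_prod_sum {α ι : Type*} (s : Finset α) (t : Finset ι)
    (ht : t.Nonempty) (c : α → ℝ) (d : ι → α → ℝ) (K : ℝ) (hK : 0 ≤ K)
    (hc : ∀ x ∈ s, 0 ≤ c x) (hd : ∀ i ∈ t, ∀ x ∈ s, 0 ≤ d i x)
    (h : ∀ x ∈ s, c x ^ t.card ≤ K * ∏ i ∈ t, d i x) :
    (∑ x ∈ s, c x) ^ t.card ≤ K * ∏ i ∈ t, ∑ x ∈ s, d i x := by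
  have hn : t.card ≠ 0 := Finset.card_ne_zero.mpr ht
  have hD : ∀ i ∈ t, 0 ≤ ∑ x ∈ s, d i x := fun i hi => Finset.sum_nonneg (hd i hi)
  rcases (mul_nonneg hK (Finset.prod_nonneg hD)).eq_or_lt with h0 | hpos
  · rw [← h0]
    have : ∀ x ∈ s, c x = 0 := by
      intro x hx
      have h1 : K * ∏ i ∈ t, d i x = 0 := by
        rcases mul_eq_zero.mp h0.symm with h2 | h2
        · simp [h2]
        · obtain ⟨i, hi, h3⟩ := Finset.prod_eq_zero_iff.mp h2
          rw [Finset.sum_eq_zero_iff_of_nonneg (hd i hi)] at h3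
          rw [Finset.prod_eq_zero hi (h3 x hx), mul_zero]
      exact pow_eq_zero_iff hn |>.mp
        (le_antisymm (h1 ▸ h x hx) (pow_nonneg (hc x hx) _))
    rw [Finset.sum_eq_zero this, zero_pow hn]
  have hDpos : ∀ i ∈ t, 0 < ∑ x ∈ s, d i x := by
    intro i hi
    refine (hD i hi).lt_of_ne fun h0 => hpos.ne' ?_
    rw [Finset.prod_eq_zero hi h0.symm, mul_zero]
  set P := K * ∏ i ∈ t, ∑ x ∈ s, d i x with hP
  have hKpos : 0 < K := hK.lt_of_ne fun h0 => hpos.ne' (by rw [hP, ← h0, zero_mul])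
  set T := P ^ ((t.card : ℝ)⁻¹) with hT
  have hTpow : T ^ t.card = P := Real.rpow_inv_natCast_pow hpos.le hn
  have hTpos : 0 < T := Real.rpow_pos_of_pos hpos _
  have key : ∀ x ∈ s, c x / T ≤ ∑ i ∈ t, (t.card : ℝ)⁻¹ * (d i x / ∑ y ∈ s, d i y) := by
    intro x hx
    have hz : ∀ i ∈ t, 0 ≤ d i x / ∑ y ∈ s, d i y :=
      fun i hi => div_nonneg (hd i hi x hx) (hD i hi)
    refine le_trans ?_ (Real.geom_mean_le_arith_mean_weighted t (fun _ => (t.card : ℝ)⁻¹) _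
      (fun _ _ => by positivity) (by simp [hn]) hz)
    refine le_of_pow_le_pow_left₀ hn
      (Finset.prod_nonneg fun i hi => Real.rpow_nonneg (hz i hi) _) ?_
    rw [← Finset.prod_pow, Finset.prod_congr rfl
      fun i hi => Real.rpow_inv_natCast_pow (hz i hi) hn, div_pow, hTpow, div_le_iff₀ hpos, hP,
      Finset.prod_div_distrib]
    refine (h x hx).trans_eq ?_
    have := (Finset.prod_pos hDpos).ne'
    field_simp
  have hsum : (∑ x ∈ s, c x) / T ≤ 1 := by
    rw [Finset.sum_div]
    refine (Finset.sum_le_sum key).trans_eq ?_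
    rw [Finset.sum_comm]
    simp_rw [← Finset.mul_sum, ← Finset.sum_div]
    rw [Finset.sum_congr rfl fun i hi => div_self (hDpos i hi).ne']
    simp [hn]
  rw [← hTpow]
  exact pow_le_pow_left₀ (Finset.sum_nonneg hc) ((div_le_one hTpos).mp hsum) _

/-- Discrete Loomis–Whitney inequality. -/
theorem card_pow_le_prod_card_image_removeNth {V : Type*} [DecidableEq V] (n : ℕ)
    (A : Finset (Fin (n + 1) → V)) (hA : A.Nonempty) :
    (A.card : ℝ) ^ n ≤ ∏ i, ((A.image (Fin.removeNth i)).card : ℝ) := by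
  induction n with
  | zero => simpa using hA
  | succ n ih =>
    set s := A.image (fun f => f 0)
    let slice : V → Finset (Fin (n + 1) → V) := fun x =>
      (A.filter (fun f => f 0 = x)).image Fin.tail
    have hinj : ∀ x, Set.InjOn (Fin.tail : (Fin (n + 2) → V) → _)
        (A.filter (fun f => f 0 = x) : Finset _) := by
      intro x f hf g hg hfg
      simp only [Finset.coe_filter, Set.mem_ofPred_eq] at hf hg
      rw [← Fin.cons_self_tail f, ← Fin.cons_self_tail g, hfg, hf.2, hg.2]
    have hslice : ∀ x, (slice x).card = (A.filter (fun f => f 0 = x)).card :=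
      fun x => Finset.card_image_of_injOn (hinj x)
    have hAcard : (A.card : ℝ) = ∑ x ∈ s, ((slice x).card : ℝ) := by
      simp_rw [hslice]
      exact_mod_cast Finset.card_eq_sum_card_image (fun f : Fin (n + 2) → V => f 0) A
    have hproj : ∀ i : Fin (n + 1), ∑ x ∈ s, (((slice x).image (Fin.removeNth i)).card : ℝ) ≤
        ((A.image (Fin.removeNth i.succ)).card : ℝ) := by
      intro i
      have : ∀ x ∈ s, ((slice x).image (Fin.removeNth i)).card ≤
          ((A.image (Fin.removeNth i.succ)).filter (fun g => g 0 = x)).card := by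
        intro x _
        rw [← Finset.card_image_of_injective _ (Fin.cons_right_injective (α := fun _ => V) x)]
        apply Finset.card_le_card
        intro g hg
        simp only [slice, Finset.mem_image, Finset.mem_filter] at hg ⊢
        obtain ⟨_, ⟨_, ⟨f, ⟨hf, rfl⟩, rfl⟩, rfl⟩, rfl⟩ := hg
        refine ⟨⟨f, hf, ?_⟩, rfl⟩
        funext j
        refine Fin.cases ?_ (fun j => ?_) j
        · rfl
        · exact congrArg f (Fin.succ_succAbove_succ i j)
      have h2 := (Finset.sum_le_sum this).trans
        ((Finset.sum_card_fiberwise_eq_card_filter _ _ _).trans_le (Finset.card_filter_le _ _))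
      exact_mod_cast h2
    rw [Fin.prod_univ_succ, hAcard]
    have := sum_pow_card_le_mul_prod_sum s (Finset.univ : Finset (Fin (n + 1))) ⟨0, by simp⟩
      (fun x => ((slice x).card : ℝ)) (fun i x => (((slice x).image (Fin.removeNth i)).card : ℝ))
      ((A.image (Fin.removeNth 0)).card : ℝ) (Nat.cast_nonneg _) (fun _ _ => Nat.cast_nonneg _)
      (fun _ _ _ _ => Nat.cast_nonneg _) ?_
    · simp only [Finset.card_univ, Fintype.card_fin] at this
      refine this.trans ?_
      exact mul_le_mul_of_nonneg_left (Finset.prod_le_prod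
        (fun _ _ => Finset.sum_nonneg fun _ _ => Nat.cast_nonneg _) fun i _ => hproj i)
        (Nat.cast_nonneg _)
    · intro x hx
      rw [Finset.card_univ, Fintype.card_fin, pow_succ']
      have hsub : slice x ⊆ A.image (Fin.removeNth 0) := by
        intro g hg
        obtain ⟨f, hf, rfl⟩ := Finset.mem_image.mp hg
        exact Finset.mem_image.mpr ⟨f, (Finset.mem_filter.mp hf).1, Fin.removeNth_zero f⟩
      refine mul_le_mul (by exact_mod_cast Finset.card_le_card hsub) (ih _ ?_)
        (by positivity) (by positivity)
      obtain ⟨f, hf, rfl⟩ := Finset.mem_image.mp hx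
      exact ⟨Fin.tail f, Finset.mem_image_of_mem _ (by simp [hf])⟩

/-- A case of the AM–GM inequality. -/
theorem mul_div_pow_le_div_pow (k : ℕ) (a b : ℝ) (ha : 0 ≤ a) (hb : 0 ≤ b) :
    a * (b / k) ^ k ≤ ((a + b) / (k + 1 : ℕ)) ^ (k + 1) := by
  rcases Nat.eq_zero_or_pos k with rfl | hk
  · simpa
  have hk' : (0 : ℝ) < k := by exact_mod_cast hk
  rcases hb.eq_or_lt with rfl | hb
  · rw [zero_div, zero_pow hk.ne', mul_zero]; positivity
  set c := b / k with hc
  have hcpos : 0 < c := by positivity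
  have hbc : b = k * c := by rw [hc]; field_simp
  set M := (a + b) / (k + 1 : ℕ) with hM
  have hM0 : 0 ≤ M := by positivity
  have hMa : ((k + 1 : ℕ) : ℝ) * M = a + k * c := by rw [hM, ← hbc]; field_simp
  have hMc : 0 ≤ M / c := by positivity
  have := one_add_mul_le_pow (a := M / c - 1) (by linarith) (k + 1)
  have h2 : (1 : ℝ) + ((k + 1 : ℕ) : ℝ) * (M / c - 1) = a / c := by
    rw [mul_sub, ← mul_div_assoc, hMa]; push_cast; field_simp; ring
  rw [h2, add_sub_cancel, div_pow, div_le_div_iff₀ hcpos (by positivity), pow_succ c,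
    ← mul_assoc] at this
  exact le_of_mul_le_mul_right this hcpos

/-- Consecutive terms of `g` are related, and no other terms are related in increasing order. -/
def IsInducedChain {X : Type*} (R : X → X → Prop) {k : ℕ} (g : Fin k → X) : Prop :=
  ∀ i j, i < j → (R (g i) (g j) ↔ (j : ℕ) = i + 1)

theorem IsInducedChain.tail {X : Type*} {R : X → X → Prop} {k : ℕ} {g : Fin (k + 1) → X}
    (hg : IsInducedChain R g) : IsInducedChain R (Fin.tail g) := by
  intro i j hij
  simpa [Fin.tail] using hg i.succ j.succ (by simpa using hij)

open Classical in
theorem card_inducedChain_from_le {X : Type*} [Fintype X] [DecidableEq X] (R : X → X → Prop) (k : ℕ)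
    (S : Finset X) (x : X) :
    ((Finset.univ.filter fun g : Fin (k + 1) → X =>
      IsInducedChain R g ∧ g 0 = x ∧ ∀ i : Fin k, g i.succ ∈ S).card : ℝ) ≤
      ((S.card : ℝ) / k) ^ k := by
  induction k generalizing S x with
  | zero =>
    rw [pow_zero, Nat.cast_le_one, Finset.card_le_one]
    intro f hf g hg
    simp only [Finset.mem_filter] at hf hg
    funext i
    rw [Fin.fin_one_eq_zero i, hf.2.2.1, hg.2.2.1]
  | succ k ih =>
    set Q := Finset.univ.filter fun g : Fin (k + 2) → X =>
      IsInducedChain R g ∧ g 0 = x ∧ ∀ i : Fin (k + 1), g i.succ ∈ S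
    have hinj : Set.InjOn (Fin.tail : (Fin (k + 2) → X) → _) Q := by
      intro f hf g hg hfg
      simp only [Q, Finset.coe_filter, Set.mem_ofPred_eq] at hf hg
      rw [← Fin.cons_self_tail f, ← Fin.cons_self_tail g, hfg, hf.2.2.1, hg.2.2.1]
    have hsub : Q.image Fin.tail ⊆ (S.filter (R x)).biUnion fun y =>
        Finset.univ.filter fun g : Fin (k + 1) → X =>
          IsInducedChain R g ∧ g 0 = y ∧ ∀ i : Fin k, g i.succ ∈ S.filter (fun z => ¬ R x z) := by
      intro g hg
      obtain ⟨f, hf, rfl⟩ := Finset.mem_image.mp hg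
      simp only [Q, Finset.mem_filter, Finset.mem_univ, true_and] at hf
      obtain ⟨hf, rfl, hS⟩ := hf
      simp only [Finset.mem_biUnion, Finset.mem_filter, Finset.mem_univ, true_and]
      refine ⟨f 1, ⟨hS 0, (hf 0 1 (by simp)).mpr (by simp)⟩, hf.tail, rfl, fun i => ⟨hS _, ?_⟩⟩
      rw [Fin.tail, hf 0 i.succ.succ (Fin.succ_pos _)]
      simp
    have hcard := (Finset.card_le_card hsub).trans Finset.card_biUnion_le
    rw [Finset.card_image_of_injOn hinj] at hcard
    have hsum : ((S.filter (R x)).card : ℝ) + ((S.filter fun z => ¬ R x z).card : ℝ) = S.card := by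
      exact_mod_cast Finset.card_filter_add_card_filter_not (s := S) (R x)
    calc (Q.card : ℝ) ≤ ∑ y ∈ S.filter (R x), _ := by exact_mod_cast hcard
      _ ≤ ∑ y ∈ S.filter (R x), (((S.filter fun z => ¬ R x z).card : ℝ) / k) ^ k :=
        Finset.sum_le_sum fun y _ => ih _ y
      _ = (S.filter (R x)).card * (((S.filter fun z => ¬ R x z).card : ℝ) / k) ^ k := by
        rw [Finset.sum_const, nsmul_eq_mul]
      _ ≤ _ := by
        rw [← hsum]
        exact mul_div_pow_le_div_pow k _ _ (by positivity) (by positivity)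

open Classical in
theorem card_inducedChain_le {X : Type*} [Fintype X] [DecidableEq X] (R : X → X → Prop)
    (k : ℕ) (S : Finset X) :
    ((Finset.univ.filter fun g : Fin (k + 1) → X =>
      IsInducedChain R g ∧ ∀ i, g i ∈ S).card : ℝ) ≤ S.card * ((S.card : ℝ) / k) ^ k := by
  have hsub : (Finset.univ.filter fun g : Fin (k + 1) → X =>
      IsInducedChain R g ∧ ∀ i, g i ∈ S) ⊆ S.biUnion fun y =>
        Finset.univ.filter fun g : Fin (k + 1) → X =>
          IsInducedChain R g ∧ g 0 = y ∧ ∀ i : Fin k, g i.succ ∈ S := by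
    intro g hg
    simp only [Finset.mem_biUnion, Finset.mem_filter, Finset.mem_univ, true_and] at hg ⊢
    exact ⟨g 0, hg.2 0, hg.1, rfl, fun i => hg.2 _⟩
  calc _ ≤ ((∑ y ∈ S, _ : ℕ) : ℝ) := by
        exact_mod_cast (Finset.card_le_card hsub).trans Finset.card_biUnion_le
    _ ≤ ∑ y ∈ S, ((S.card : ℝ) / k) ^ k := by
      rw [Nat.cast_sum]
      exact Finset.sum_le_sum fun y _ => card_inducedChain_from_le R k S y
    _ = _ := by rw [Finset.sum_const, nsmul_eq_mul]

open Classical in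
/-- Maps of the `n`-cycle into `G` preserving and reflecting adjacency. -/
noncomputable def labelledCycles {V : Type*} [Fintype V] (G : SimpleGraph V) (n : ℕ) :
    Finset (Fin n → V) :=
  Finset.univ.filter fun f => ∀ i j, G.Adj (f i) (f j) ↔ (cycleGraph n).Adj i j

theorem mem_labelledCycles {V : Type*} [Fintype V] {G : SimpleGraph V} {n : ℕ} {f : Fin n → V} :
    f ∈ labelledCycles G n ↔ ∀ i j, G.Adj (f i) (f j) ↔ (cycleGraph n).Adj i j := by
  simp [labelledCycles]

/-- The dihedral symmetries of a cycle. -/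
def dihedralMap {n : ℕ} (a : Fin (n + 3) × Bool) (i : Fin (n + 3)) : Fin (n + 3) :=
  if a.2 then a.1 + i else a.1 - i

theorem dihedralMap_injective (n : ℕ) :
    Function.Injective (dihedralMap : Fin (n + 3) × Bool → _) := by
  have h2 : (1 : Fin (n + 3)) ≠ -1 := by
    intro h
    have h3 : (1 : Fin (n + 3)) + 1 = 0 := by nth_rw 1 [h]; simp
    have h4 := congrArg Fin.val h3
    rw [Fin.val_add, Fin.val_one, Fin.val_zero, Nat.mod_eq_of_lt (by omega)] at h4
    omega
  rintro ⟨a, b⟩ ⟨a', b'⟩ h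
  have h0 := congrFun h 0
  have h1 := congrFun h 1
  have haa : a = a' := by cases b <;> cases b' <;> simpa [dihedralMap] using h0
  subst haa
  cases b <;> cases b' <;>
    simp only [dihedralMap, if_true, if_false, sub_eq_add_neg, add_right_inj,
      Bool.false_eq_true] at h1 ⊢
  · exact absurd h1.symm h2
  · exact absurd h1 h2

theorem dihedralMap_surjective {n : ℕ} (a : Fin (n + 3) × Bool) :
    Function.Surjective (dihedralMap a) := by
  intro j
  unfold dihedralMap
  split_ifs
  · exact ⟨j - a.1, by abel⟩
  · exact ⟨a.1 - j, by abel⟩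

theorem cycleGraph_adj_dihedralMap {n : ℕ} (a : Fin (n + 3) × Bool) (i j : Fin (n + 3)) :
    (cycleGraph (n + 3)).Adj (dihedralMap a i) (dihedralMap a j) ↔
      (cycleGraph (n + 3)).Adj i j := by
  unfold dihedralMap
  rw [cycleGraph_adj, cycleGraph_adj]
  split_ifs
  · simp
  · rw [sub_sub_sub_cancel_left, sub_sub_sub_cancel_left, or_comm]

theorem inducedCopies_mul_le_card_labelledCycles {V : Type*} [Fintype V] (G : SimpleGraph V)
    (n : ℕ) :
    inducedCopies G (cycleGraph (n + 3)) * ((n + 3) * 2) ≤ (labelledCycles G (n + 3)).card := by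
  classical
  let T := {S : Finset V | Nonempty ((G.induce (S : Set V)) ≃g cycleGraph (n + 3))}
  let e : ∀ S : T, cycleGraph (n + 3) ≃g G.induce (S.1 : Set V) := fun S => S.2.some.symm
  let F : T × (Fin (n + 3) × Bool) → labelledCycles G (n + 3) := fun x =>
    ⟨fun i => (e x.1 (dihedralMap x.2 i)).1, mem_labelledCycles.mpr fun i j =>
      ((e x.1).map_adj_iff).trans (cycleGraph_adj_dihedralMap x.2 i j)⟩
  have hF : Function.Injective F := by
    rintro ⟨S, a⟩ ⟨S', a'⟩ h
    have h' : ∀ i, (e S (dihedralMap a i)).1 = (e S' (dihedralMap a' i)).1 :=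
      fun i => congrFun (congrArg Subtype.val h) i
    have hsub : ∀ (S S' : T) a a',
        (∀ i, (e S (dihedralMap a i)).1 = (e S' (dihedralMap a' i)).1) → S.1 ⊆ S'.1 := by
      intro S S' a a' h v hv
      obtain ⟨j, hj⟩ := (e S).surjective ⟨v, hv⟩
      obtain ⟨i, rfl⟩ := dihedralMap_surjective a j
      have h2 := h i
      rw [hj] at h2
      have h3 := (e S' (dihedralMap a' i)).2
      rwa [← h2] at h3
    have hS : S = S' := Subtype.ext
      ((hsub _ _ _ _ h').antisymm (hsub _ _ _ _ fun i => (h' i).symm))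
    subst hS
    have : a = a' := dihedralMap_injective n <| funext fun i =>
      (e S).injective (Subtype.ext (h' i))
    rw [this]
  have := Nat.card_le_card_of_injective F hF
  rw [Nat.card_prod, Nat.card_coe_set_eq] at this
  change T.ncard * _ ≤ _
  simpa using this

open Fin.CommRing in
/-- The vertices of a cycle in cyclic order, starting after `i`. -/
def cycleFrom {n : ℕ} (i : Fin (n + 3)) (t : ℕ) : Fin (n + 3) := i + 1 + (t : Fin (n + 3))

open Fin.CommRing in
theorem exists_cycleFrom_eq {n : ℕ} {i j : Fin (n + 3)} (h : j ≠ i) :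
    ∃ t < n + 2, cycleFrom i t = j := by
  have hval : cycleFrom i (j - i - 1).val = j := by
    rw [cycleFrom, Fin.cast_val_eq_self]; abel
  refine ⟨(j - i - 1).val, ?_, hval⟩
  by_contra hlt
  have h2 : (j - i - 1).val = n + 2 := by have := (j - i - 1).isLt; omega
  have h3 : ((n + 2 : ℕ) : Fin (n + 3)) = -1 := by
    rw [eq_neg_iff_add_eq_zero, ← Nat.cast_one, ← Nat.cast_add]
    exact Fin.natCast_self (n + 3)
  rw [h2, cycleFrom, h3] at hval
  exact h (by rw [← hval]; abel)

open Fin.CommRing in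
theorem cycleGraph_adj_cycleFrom {n : ℕ} (i : Fin (n + 3)) {s t : ℕ} (hs : s < n + 2)
    (ht : t < n + 2) :
    (cycleGraph (n + 3)).Adj (cycleFrom i s) (cycleFrom i t) ↔ t = s + 1 ∨ s = t + 1 := by
  have key : ∀ a b : ℕ, a < n + 2 → b < n + 2 →
      (cycleFrom i a - cycleFrom i b = 1 ↔ a = b + 1) := by
    intro a b ha hb
    rw [cycleFrom, cycleFrom, add_sub_add_left_eq_sub, sub_eq_iff_eq_add', ← Nat.cast_one,
      ← Nat.cast_add, Fin.ext_iff, Fin.val_natCast, Fin.val_natCast,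
      Nat.mod_eq_of_lt (by omega), Nat.mod_eq_of_lt (by omega)]
  rw [cycleGraph_adj, key s t hs ht, key t s ht hs, or_comm]

/-- Some vertex of `e` is adjacent to some vertex of `e'`. -/
def EdgesJoined {V : Type*} (G : SimpleGraph V) (e e' : Sym2 V) : Prop :=
  ∃ u ∈ e, ∃ v ∈ e', G.Adj u v

/-- Alternate edges of an induced path form an induced chain. -/
theorem isInducedChain_of_path {V : Type*} {G : SimpleGraph V} {k : ℕ} {p : ℕ → V}
    (hp : ∀ s < 2 * k, ∀ t < 2 * k, (G.Adj (p s) (p t) ↔ t = s + 1 ∨ s = t + 1)) :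
    IsInducedChain (EdgesJoined G) fun a : Fin k => s(p (2 * a), p (2 * a + 1)) := by
  intro a b hab
  have ha := a.isLt
  have hb := b.isLt
  have hab' : (a : ℕ) < b := hab
  simp only [EdgesJoined, Sym2.mem_iff, exists_eq_or_imp, exists_eq_left]
  rw [hp _ (by omega) _ (by omega), hp _ (by omega) _ (by omega), hp _ (by omega) _ (by omega),
    hp _ (by omega) _ (by omega)]
  omega

/-- An induced path is determined by its alternate edges. -/
theorem path_eq_of_alternate_edges_eq {V : Type*} {G : SimpleGraph V} {k : ℕ} (hk : 2 ≤ k)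
    {p q : ℕ → V}
    (hp : ∀ s < 2 * k, ∀ t < 2 * k, (G.Adj (p s) (p t) ↔ t = s + 1 ∨ s = t + 1))
    (hq : ∀ s < 2 * k, ∀ t < 2 * k, (G.Adj (q s) (q t) ↔ t = s + 1 ∨ s = t + 1))
    (h : ∀ a < k, s(p (2 * a), p (2 * a + 1)) = s(q (2 * a), q (2 * a + 1))) :
    ∀ t < 2 * k, p t = q t := by
  have key : ∀ a < k, p (2 * a) = q (2 * a) ∧ p (2 * a + 1) = q (2 * a + 1) := by
    intro a ha
    rcases Sym2.eq_iff.mp (h a ha) with h1 | ⟨h1, h2⟩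
    · exact h1
    exfalso
    by_cases hlast : a + 1 < k
    · have hadj := (hp (2 * a + 1) (by omega) (2 * (a + 1)) (by omega)).mpr (by omega)
      rw [h2] at hadj
      rcases Sym2.eq_iff.mp (h (a + 1) hlast) with ⟨h3, _⟩ | ⟨h3, _⟩ <;> rw [h3] at hadj
      · have := (hq _ (by omega) _ (by omega)).mp hadj
        omega
      · have := (hq _ (by omega) _ (by omega)).mp hadj
        omega
    · obtain ⟨b, rfl⟩ : ∃ b, a = b + 1 := ⟨a - 1, by omega⟩
      have hadj := (hp (2 * (b + 1)) (by omega) (2 * b + 1) (by omega)).mpr (by omega)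
      rw [h1] at hadj
      rcases Sym2.eq_iff.mp (h b (by omega)) with ⟨_, h3⟩ | ⟨_, h3⟩ <;> rw [h3] at hadj
      · have := (hq _ (by omega) _ (by omega)).mp hadj
        omega
      · have := (hq _ (by omega) _ (by omega)).mp hadj
        omega
  intro t ht
  rcases Nat.even_or_odd' t with ⟨a, rfl | rfl⟩
  · exact (key a (by omega)).1
  · exact (key a (by omega)).2

theorem card_image_le_card_image_of_determined {α β γ : Type*} [DecidableEq β] [DecidableEq γ]
    (s : Finset α) (φ : α → β) (ψ : α → γ) (h : ∀ x ∈ s, ∀ y ∈ s, ψ x = ψ y → φ x = φ y) :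
    (s.image φ).card ≤ (s.image ψ).card := by
  rcases s.eq_empty_or_nonempty with rfl | ⟨x₀, -⟩
  · simp
  have : Nonempty α := ⟨x₀⟩
  choose! r hr using fun c (hc : c ∈ s.image ψ) => Finset.mem_image.mp hc
  refine (Finset.card_le_card fun b hb => ?_).trans
    (Finset.card_image_le (s := s.image ψ) (f := fun c => φ (r c)))
  obtain ⟨x, hx, rfl⟩ := Finset.mem_image.mp hb
  have hx' := Finset.mem_image_of_mem ψ hx
  exact Finset.mem_image.mpr ⟨ψ x, hx', h _ (hr _ hx').1 _ hx (hr _ hx').2⟩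

open Classical in
theorem card_image_removeNth_labelledCycles_le {V : Type*} [Fintype V] (G : SimpleGraph V) (k : ℕ)
    (i : Fin (2 * k + 5)) :
    (((labelledCycles G (2 * k + 5)).image (Fin.removeNth i)).card : ℝ) ≤
      G.edgeFinset.card * ((G.edgeFinset.card : ℝ) / (k + 1 : ℕ)) ^ (k + 1) := by
  refine le_trans ?_ (card_inducedChain_le (EdgesJoined G) (k + 1) G.edgeFinset)
  rw [Nat.cast_le]
  have hpath : ∀ f ∈ labelledCycles G (2 * k + 5), ∀ s < 2 * (k + 2), ∀ t < 2 * (k + 2),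
      (G.Adj (f (cycleFrom i s)) (f (cycleFrom i t)) ↔ t = s + 1 ∨ s = t + 1) := by
    intro f hf s hs t ht
    exact (mem_labelledCycles.mp hf _ _).trans (cycleGraph_adj_cycleFrom i hs ht)
  let ψ : (Fin (2 * k + 5) → V) → Fin (k + 2) → Sym2 V := fun f a =>
    s(f (cycleFrom i (2 * a)), f (cycleFrom i (2 * a + 1)))
  calc ((labelledCycles G (2 * k + 5)).image (Fin.removeNth i)).card
      ≤ ((labelledCycles G (2 * k + 5)).image ψ).card := by
        refine card_image_le_card_image_of_determined _ _ _ fun f hf g hg hfg => ?_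
        have h := path_eq_of_alternate_edges_eq (by omega) (hpath f hf) (hpath g hg)
          fun a ha => congrFun hfg ⟨a, ha⟩
        funext j
        obtain ⟨t, ht, htj⟩ := exists_cycleFrom_eq (Fin.succAbove_ne i j)
        have := h t ht
        rwa [htj] at this
    _ ≤ _ := by
        apply Finset.card_le_card
        intro g hg
        obtain ⟨f, hf, rfl⟩ := Finset.mem_image.mp hg
        refine Finset.mem_filter.mpr
          ⟨Finset.mem_univ _, isInducedChain_of_path (hpath f hf), fun a => ?_⟩
        rw [mem_edgeFinset, mem_edgeSet]
        have := a.isLt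
        exact (hpath f hf _ (by omega) _ (by omega)).mpr (by omega)

theorem card_labelledCycles_pow_le {V : Type*} [Fintype V] (G : SimpleGraph V) (k : ℕ) :
    ((labelledCycles G (2 * k + 5)).card : ℝ) ^ (2 * k + 4) ≤
      ((G.edgeSet.ncard : ℝ) * ((G.edgeSet.ncard : ℝ) / (k + 1 : ℕ)) ^ (k + 1)) ^ (2 * k + 5) := by
  classical
  rcases (labelledCycles G (2 * k + 5)).eq_empty_or_nonempty with h | h
  · rw [h, Finset.card_empty, Nat.cast_zero, zero_pow (by omega)]; positivity
  refine (card_pow_le_prod_card_image_removeNth (2 * k + 4) _ h).trans ?_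
  refine (Finset.prod_le_prod (fun _ _ => Nat.cast_nonneg _)
    fun i _ => card_image_removeNth_labelledCycles_le G k i).trans_eq ?_
  rw [Finset.prod_const, Finset.card_univ, Fintype.card_fin, ← coe_edgeFinset,
    Set.ncard_coe_finset]

theorem odd_cycle_upper_bound (l : ℕ) (hl : 2 ≤ l) {V : Type*} [Fintype V]
    (G : SimpleGraph V) (m : ℕ) (hG : G.edgeSet.ncard = m) :
    (inducedCopies G (SimpleGraph.cycleGraph (2 * l + 1)) : ℝ) ≤
      (2 * (l : ℝ) + 1) ^ ((l : ℝ) - 1 / 2) /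
        (2 * ((l : ℝ) - 1) ^ (((l : ℝ) - 1) * (2 * (l : ℝ) + 1) / (2 * (l : ℝ)))) *
        ((m : ℝ) / (2 * (l : ℝ) + 1)) ^ ((2 * (l : ℝ) + 1) / 2) := by
  obtain ⟨k, rfl⟩ : ∃ k, l = k + 2 := ⟨l - 2, by omega⟩
  have hcopies := inducedCopies_mul_le_card_labelledCycles G (2 * k + 2)
  have hpow := card_labelledCycles_pow_le G k
  rw [hG] at hpow
  have hcopies' : (inducedCopies G (cycleGraph (2 * (k + 2) + 1)) : ℝ) * ((2 * k + 5) * 2) ≤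
      ((labelledCycles G (2 * k + 5)).card : ℝ) := by exact_mod_cast hcopies
  set c := (inducedCopies G (cycleGraph (2 * (k + 2) + 1)) : ℝ)
  have hm : (0 : ℝ) ≤ m := Nat.cast_nonneg m
  have hcast : ((k + 2 : ℕ) : ℝ) = k + 2 := by push_cast; ring
  rw [hcast]
  have hb : (0 : ℝ) < (k + 2 : ℝ) - 1 := by
    have : (0 : ℝ) ≤ k := Nat.cast_nonneg k
    linarith
  have hn : (0 : ℝ) < 2 * (k + 2 : ℝ) + 1 := by positivity
  set B := ((k : ℝ) + 2 - 1) ^ (((k : ℝ) + 2 - 1) * (2 * ((k : ℝ) + 2) + 1) / (2 * ((k : ℝ) + 2)))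
    with hB
  have hBpos : 0 < B := Real.rpow_pos_of_pos hb _
  have hBpow : B ^ (2 * k + 4) = ((k : ℝ) + 1) ^ ((k + 1) * (2 * k + 5)) := by
    rw [hB, ← Real.rpow_natCast, ← Real.rpow_mul hb.le, ← Real.rpow_natCast]
    congr 1
    · ring
    · push_cast; field_simp; ring
  set M := (m : ℝ) ^ ((2 * ((k : ℝ) + 2) + 1) / 2) with hM
  have hM0 : 0 ≤ M := Real.rpow_nonneg hm _
  have hMpow : M ^ (2 * k + 4) = (m : ℝ) ^ ((k + 2) * (2 * k + 5)) := by
    rw [hM, ← Real.rpow_natCast, ← Real.rpow_mul hm, ← Real.rpow_natCast]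
    congr 1
    push_cast; ring
  have hbound : c * ((2 * k + 5) * 2) ≤ M / B := by
    refine hcopies'.trans (le_of_pow_le_pow_left₀ (n := 2 * k + 4) (by omega) (by positivity) ?_)
    refine hpow.trans_eq ?_
    rw [div_pow M, hMpow, hBpow, div_pow, mul_div_assoc', ← pow_succ', div_pow, ← pow_mul,
      ← pow_mul]
    push_cast
    rfl
  have hexp : (2 * ((k : ℝ) + 2) + 1) ^ ((2 * ((k : ℝ) + 2) + 1) / 2) =
      (2 * ((k : ℝ) + 2) + 1) ^ ((k : ℝ) + 2 - 1 / 2) * (2 * ((k : ℝ) + 2) + 1) := by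
    rw [← Real.rpow_add_one hn.ne']
    congr 1
    ring
  rw [Real.div_rpow hm hn.le, ← hM, hexp]
  have hE : (0 : ℝ) < (2 * ((k : ℝ) + 2) + 1) ^ ((k : ℝ) + 2 - 1 / 2) := Real.rpow_pos_of_pos hn _
  calc c ≤ M / B / ((2 * k + 5) * 2) := (le_div_iff₀ (by positivity)).mpr hbound
    _ = _ := by
      have : (2 * (k : ℝ) + 5) = 2 * ((k : ℝ) + 2) + 1 := by ring
      rw [this]
      field_simp
end

section
/- Let k ≥ 5 be an integer and ε ∈ (0,1). Then there exists M such that for every integer m ≥ M there exists a finite simple graph G with at most m edges containing at least (1−ε) · (m/k)^{k/2} induced copies of the cycle C_k on k vertices. -/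
open SimpleGraph

/-- The balanced blow-up of the cycle of length `k` with parts of size `N`. -/
def cycleBlowup (k N : ℕ) : SimpleGraph (Fin (k * N)) :=
  (SimpleGraph.cycleGraph k).comap fun x => (finProdFinEquiv.symm x).1

theorem cycleBlowup_ncard_edgeSet_le {k : ℕ} (hk : 2 ≤ k) (N : ℕ) :
    (cycleBlowup k N).edgeSet.ncard ≤ k * N ^ 2 := by
  obtain ⟨j, rfl⟩ := Nat.exists_eq_add_of_le' hk
  let g : Fin (j + 2) × Fin N × Fin N → Sym2 (Fin ((j + 2) * N)) := fun p =>
    s(finProdFinEquiv (p.1, p.2.1), finProdFinEquiv (p.1 + 1, p.2.2))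
  have hsub : (cycleBlowup (j + 2) N).edgeSet ⊆ g '' Set.univ := by
    intro e
    induction e using Sym2.ind with
    | _ x y =>
      obtain ⟨⟨a, b⟩, rfl⟩ := finProdFinEquiv.surjective x
      obtain ⟨⟨c, d⟩, rfl⟩ := finProdFinEquiv.surjective y
      intro h
      simp only [cycleBlowup, SimpleGraph.mem_edgeSet, SimpleGraph.comap_adj,
        Equiv.symm_apply_apply, SimpleGraph.cycleGraph_adj] at h
      rcases h with h | h
      · obtain rfl : a = c + 1 := by rw [← h]; abel
        exact ⟨(c, d, b), Set.mem_univ _, Sym2.eq_swap⟩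
      · obtain rfl : c = a + 1 := by rw [← h]; abel
        exact ⟨(a, b, d), Set.mem_univ _, rfl⟩
  calc (cycleBlowup (j + 2) N).edgeSet.ncard
      ≤ (g '' Set.univ).ncard := Set.ncard_le_ncard hsub (Set.toFinite _)
    _ ≤ (Set.univ : Set (Fin (j + 2) × Fin N × Fin N)).ncard := Set.ncard_image_le
    _ = (j + 2) * N ^ 2 := by
      rw [Set.ncard_univ, Nat.card_eq_fintype_card]
      simp [pow_two]

theorem pow_le_inducedCopies_cycleBlowup (k N : ℕ) :
    N ^ k ≤ inducedCopies (cycleBlowup k N) (SimpleGraph.cycleGraph k) := by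
  let s : (Fin k → Fin N) → Fin k → Fin (k * N) := fun f i => finProdFinEquiv (i, f i)
  have hs (f : Fin k → Fin N) : Function.Injective (s f) := fun i j h =>
    congrArg Prod.fst (finProdFinEquiv.injective h)
  let T : (Fin k → Fin N) → Finset (Fin (k * N)) := fun f => Finset.univ.image (s f)
  have hT : Function.Injective T := by
    intro f g h
    funext i
    have hi : s f i ∈ T g := h ▸ Finset.mem_image_of_mem _ (Finset.mem_univ i)
    obtain ⟨j, -, hj⟩ := Finset.mem_image.mp hi
    have hj' := Prod.ext_iff.mp (finProdFinEquiv.injective hj)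
    obtain rfl : j = i := hj'.1
    exact hj'.2.symm
  have hsub : T '' Set.univ ⊆ {S : Finset (Fin (k * N)) | Nonempty
      (((cycleBlowup k N).induce (S : Set (Fin (k * N)))) ≃g SimpleGraph.cycleGraph k)} := by
    rintro _ ⟨f, -, rfl⟩
    have hrange : (T f : Set (Fin (k * N))) = Set.range (s f) := by simp [T]
    rw [Set.mem_ofPred_eq, hrange]
    refine ⟨RelIso.symm ⟨Equiv.ofInjective (s f) (hs f), ?_⟩⟩
    intro a b
    simp only [cycleBlowup, s, SimpleGraph.comap_adj, Function.Embedding.subtype_apply,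
      Equiv.ofInjective_apply, Equiv.symm_apply_apply]
  calc N ^ k = (T '' Set.univ).ncard := by
        rw [Set.ncard_image_of_injective _ hT, Set.ncard_univ, Nat.card_eq_fintype_card]
        simp
    _ ≤ _ := Set.ncard_le_ncard hsub (Set.toFinite _)

theorem one_sub_mul_pow_le_floor_pow {k : ℕ} {ε x : ℝ} (hε : 0 < ε) (hx : 1 ≤ x)
    (hkx : k / ε ≤ x) : (1 - ε) * x ^ k ≤ (⌊x⌋₊ : ℝ) ^ k := by
  have hx0 : 0 < x := one_pos.trans_le hx
  have hinv : x⁻¹ ≤ 1 := inv_le_one_of_one_le₀ hx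
  have hbern := one_add_mul_le_pow (a := -x⁻¹) (by linarith) k
  have hke : k * x⁻¹ ≤ ε := by
    rw [← div_eq_mul_inv, div_le_iff₀ hx0, mul_comm]
    exact (div_le_iff₀ hε).mp hkx
  calc (1 - ε) * x ^ k ≤ (1 + -x⁻¹) ^ k * x ^ k := by
        gcongr
        linarith
    _ = (x - 1) ^ k := by
        rw [← mul_pow]
        congr 1
        field_simp
        ring
    _ ≤ (⌊x⌋₊ : ℝ) ^ k :=
        pow_le_pow_left₀ (by linarith) (Nat.sub_one_lt_floor x).le k

theorem cycle_lower_bound (k : ℕ) (hk : 5 ≤ k) (ε : ℝ) (hε : ε ∈ Set.Ioo (0 : ℝ) 1) :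
    ∃ M : ℕ, ∀ m : ℕ, M ≤ m → ∃ (n : ℕ) (G : SimpleGraph (Fin n)),
      G.edgeSet.ncard ≤ m ∧
      (1 - ε) * ((m : ℝ) / (k : ℝ)) ^ ((k : ℝ) / 2) ≤
        (inducedCopies G (SimpleGraph.cycleGraph k) : ℝ) := by
  obtain ⟨hε0, hε1⟩ := hε
  have hk1 : (1 : ℝ) ≤ k := by exact_mod_cast (by omega : 1 ≤ k)
  have hk0 : (0 : ℝ) < k := by linarith
  refine ⟨⌈k * (k / ε) ^ 2⌉₊, fun m hm => ?_⟩
  set x : ℝ := √(m / k) with hx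
  have hq : (0 : ℝ) ≤ m / k := by positivity
  have hkx : k / ε ≤ x := by
    refine Real.le_sqrt_of_sq_le ((le_div_iff₀ hk0).mpr ?_)
    rw [mul_comm]
    exact Nat.ceil_le.mp hm
  have hx1 : 1 ≤ x := ((one_le_div hε0).mpr (by linarith)).trans hkx
  refine ⟨k * ⌊x⌋₊, cycleBlowup k ⌊x⌋₊,
    (cycleBlowup_ncard_edgeSet_le (by omega) _).trans ?_, ?_⟩
  · have hfloor : (⌊x⌋₊ : ℝ) ^ 2 ≤ m / k :=
      (pow_le_pow_left₀ (by positivity) (Nat.floor_le (by linarith)) 2).trans_eq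
        (Real.sq_sqrt hq)
    rw [le_div_iff₀ hk0, mul_comm] at hfloor
    exact_mod_cast hfloor
  · have hpow : ((m : ℝ) / k) ^ ((k : ℝ) / 2) = x ^ k := by
      rw [hx, Real.sqrt_eq_rpow, ← Real.rpow_mul_natCast hq]
      congr 1
      ring
    rw [hpow]
    refine (one_sub_mul_pow_le_floor_pow hε0 hx1 hkx).trans ?_
    exact_mod_cast pow_le_inducedCopies_cycleBlowup k ⌊x⌋₊
end

section
/- Let H be a finite simple graph and let A ⊆ V(H) be an independent set that maximizes the quantity f(S) := |S| + (1/2)(|V(H)| − |S| − |N(S)|) over all independent sets S of H. Then for every subset W ⊆ N(A), the number of vertices of A adjacent to at least one vertex of W is at least |W|; consequently, H contains a matching of size |N(A)| in which every edge joins a vertex of N(A) to a vertex of A. -/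
open SimpleGraph

theorem hall_condition_for_extremal_independent_set {V : Type*} [Fintype V]
    [DecidableEq V] (H : SimpleGraph V) [DecidableRel H.Adj]
    (A : Finset V) (hA : ∀ u ∈ A, ∀ v ∈ A, ¬ H.Adj u v)
    (hmax : ∀ S : Finset V, (∀ u ∈ S, ∀ v ∈ S, ¬ H.Adj u v) →
      (S.card : ℝ) + (1 / 2) * ((Fintype.card V : ℝ) - S.card - (finNbhd H S).card) ≤
        (A.card : ℝ) + (1 / 2) * ((Fintype.card V : ℝ) - A.card - (finNbhd H A).card)) :
    (∀ W ⊆ finNbhd H A,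
      W.card ≤ (A.filter (fun a => ∃ w ∈ W, H.Adj a w)).card) ∧
    ∃ φ : V → V, Set.InjOn φ (finNbhd H A : Set V) ∧
      ∀ b ∈ finNbhd H A, φ b ∈ A ∧ H.Adj b (φ b) := by
  have hall : ∀ W ⊆ finNbhd H A,
      W.card ≤ (A.filter (fun a => ∃ w ∈ W, H.Adj a w)).card := by
    intro W hW
    set T := A.filter (fun a => ∃ w ∈ W, H.Adj a w) with hT
    have hopt := hmax (A \ T) fun u hu v hv =>
      hA u (Finset.mem_sdiff.1 hu).1 v (Finset.mem_sdiff.1 hv).1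
    have hsub : finNbhd H (A \ T) ⊆ finNbhd H A \ W := by
      intro v hv
      obtain ⟨u, hu, huv⟩ := (Finset.mem_filter.1 hv).2
      obtain ⟨huA, huT⟩ := Finset.mem_sdiff.1 hu
      exact Finset.mem_sdiff.2
        ⟨Finset.mem_filter.2 ⟨Finset.mem_univ v, u, huA, huv⟩,
          fun hvW => huT (Finset.mem_filter.2 ⟨huA, v, hvW, huv⟩)⟩
    have hN := Finset.card_le_card hsub
    have hNW := Finset.card_sdiff_add_card_eq_card hW
    have hAT := Finset.card_sdiff_add_card_eq_card (Finset.filter_subset _ A : T ⊆ A)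
    have hN' : (finNbhd H (A \ T)).card + W.card ≤ (finNbhd H A).card := by omega
    rify at hN' hAT ⊢
    linarith
  refine ⟨hall, ?_⟩
  obtain ⟨f, hf, hfA⟩ := (Finset.all_card_le_biUnion_card_iff_exists_injective
    fun b : finNbhd H A => A.filter (H.Adj b)).1 fun s => by
      have hs := hall (s.map (Function.Embedding.subtype _)) fun b hb => by
        obtain ⟨c, -, rfl⟩ := Finset.mem_map.1 hb
        exact c.2
      rw [Finset.card_map] at hs
      refine hs.trans (Finset.card_le_card fun a ha => ?_)
      obtain ⟨haA, w, hw, haw⟩ := Finset.mem_filter.1 ha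
      obtain ⟨c, hc, rfl⟩ := Finset.mem_map.1 hw
      exact Finset.mem_biUnion.2 ⟨c, hc, Finset.mem_filter.2 ⟨haA, haw.symm⟩⟩
  refine ⟨fun b => if hb : b ∈ finNbhd H A then f ⟨b, hb⟩ else b, ?_, ?_⟩
  · intro b hb c hc hbc
    rw [Finset.mem_coe] at hb hc
    simp only [hb, hc, dite_true] at hbc
    exact congrArg Subtype.val (hf hbc)
  · intro b hb
    simp only [hb, dite_true]
    exact Finset.mem_filter.1 (hfA ⟨b, hb⟩)
end

section
/- Let H be a finite simple graph and let A ⊆ V(H) be an independent set that maximizes the quantity f(S) := |S| + (1/2)(|V(H)| − |S| − |N(S)|) over all independent sets S of H. Let C = V(H) \ (A ∪ N(A)). Then the fractional independence number of the induced subgraph H[C] equals |C|/2. -/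
open SimpleGraph

/-- If every independent set of `G` has at least as many neighbours as vertices, then every
fractional independent set has weight at most `|V(G)| / 2`. -/
theorem sum_le_card_div_two_of_forall_card_le_card_finNbhd {W : Type*} [Fintype W]
    (G : SimpleGraph W) [DecidableRel G.Adj]
    (h : ∀ S : Finset W, (∀ u ∈ S, ∀ v ∈ S, ¬ G.Adj u v) → S.card ≤ (finNbhd G S).card)
    (ω : W → ℝ) (hω : ∀ u v, G.Adj u v → ω u + ω v ≤ 1) :
    ∑ v, ω v ≤ (Fintype.card W : ℝ) / 2 := by
  classical
  obtain ⟨f, hf, hfadj⟩ := (Finset.all_card_le_biUnion_card_iff_exists_injective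
    (fun v : {v // 1 / 2 < ω v} => Finset.univ.filter (G.Adj v))).1 (by
      intro S
      have hS := h (S.map (Function.Embedding.subtype _)) (by
        intro u hu v hv huv
        simp only [Finset.mem_map, Function.Embedding.subtype_apply] at hu hv
        obtain ⟨a, -, rfl⟩ := hu
        obtain ⟨b, -, rfl⟩ := hv
        linarith [hω _ _ huv, a.2, b.2])
      rw [Finset.card_map] at hS
      refine hS.trans (Finset.card_le_card fun w hw => ?_)
      simp only [finNbhd, Finset.mem_filter, Finset.mem_univ, true_and, Finset.mem_map,
        Function.Embedding.subtype_apply] at hw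
      obtain ⟨_, ⟨a, ha, rfl⟩, haw⟩ := hw
      exact Finset.mem_biUnion.2 ⟨a, ha, by simpa using haw⟩)
  have hpair : ∀ v : {v // 1 / 2 < ω v}, ω v + ω (f v) ≤ 1 := fun v => hω _ _ (by simpa using hfadj v)
  have hsub : Finset.univ.map ⟨f, hf⟩ ⊆ Finset.univ.filter (fun v => ¬ 1 / 2 < ω v) := by
    intro w hw
    simp only [Finset.mem_map, Finset.mem_univ, true_and, Function.Embedding.coeFn_mk] at hw
    obtain ⟨v, rfl⟩ := hw
    simp only [Finset.mem_filter, Finset.mem_univ, true_and]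
    linarith [hpair v, v.2]
  have hneg := Finset.sum_le_sum_of_subset_of_nonneg (f := fun v => 1 / 2 - ω v) hsub (by
    intro v hv _
    simp only [Finset.mem_filter, Finset.mem_univ, true_and] at hv
    linarith)
  rw [Finset.sum_map] at hneg
  have hpos : ∑ v ∈ Finset.univ.filter (fun v => 1 / 2 < ω v), (1 / 2 - ω v) =
      ∑ v : {v // 1 / 2 < ω v}, (1 / 2 - ω v) :=
    Finset.sum_subtype _ (by simp) _
  have hsum : 0 ≤ ∑ v : {v // 1 / 2 < ω v}, ((1 / 2 - ω v) + (1 / 2 - ω (f v))) :=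
    Finset.sum_nonneg fun v _ => by linarith [hpair v]
  rw [Finset.sum_add_distrib] at hsum
  have hsplit := Finset.sum_filter_add_sum_filter_not Finset.univ
    (fun v => 1 / 2 < ω v) (fun v => 1 / 2 - ω v)
  have htotal : ∑ v, (1 / 2 - ω v) = (Fintype.card W : ℝ) / 2 - ∑ v, ω v := by
    rw [Finset.sum_sub_distrib]
    simp [div_eq_mul_inv]
  simp only [Function.Embedding.coeFn_mk] at hneg
  linarith

/-- If every independent set of `G` has at least as many neighbours as vertices, then the
fractional independence number of `G` is `|V(G)| / 2`. -/
theorem fracIndepNum_eq_card_div_two {W : Type*} [Fintype W]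
    (G : SimpleGraph W) [DecidableRel G.Adj]
    (h : ∀ S : Finset W, (∀ u ∈ S, ∀ v ∈ S, ¬ G.Adj u v) → S.card ≤ (finNbhd G S).card) :
    fracIndepNum G = (Fintype.card W : ℝ) / 2 := by
  refine IsGreatest.csSup_eq ⟨⟨fun _ => 1 / 2, fun _ => by norm_num, fun _ _ _ => by norm_num,
    by simp [div_eq_mul_inv]⟩, ?_⟩
  rintro x ⟨ω, -, hω, rfl⟩
  exact sum_le_card_div_two_of_forall_card_le_card_finNbhd G h ω hω

theorem frac_indep_of_complement_part {V : Type*} [Fintype V]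
    [DecidableEq V] (H : SimpleGraph V) [DecidableRel H.Adj]
    (A : Finset V) (hA : ∀ u ∈ A, ∀ v ∈ A, ¬ H.Adj u v)
    (hmax : ∀ S : Finset V, (∀ u ∈ S, ∀ v ∈ S, ¬ H.Adj u v) →
      (S.card : ℝ) + (1 / 2) * ((Fintype.card V : ℝ) - S.card - (finNbhd H S).card) ≤
        (A.card : ℝ) + (1 / 2) * ((Fintype.card V : ℝ) - A.card - (finNbhd H A).card))
    (C : Finset V) (hC : C = Finset.univ \ (A ∪ finNbhd H A)) :
    fracIndepNum (H.induce (C : Set V)) = (C.card : ℝ) / 2 := by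
  subst hC
  have hdis : ∀ a ∈ A, ∀ v : ↥((Finset.univ \ (A ∪ finNbhd H A) : Finset V) : Set V),
      v.1 ≠ a ∧ ¬ H.Adj a v.1 := by
    rintro a ha ⟨v, hv⟩
    simp only [finNbhd, Finset.coe_sdiff, Finset.coe_univ, Finset.coe_union, Set.mem_sdiff,
      Set.mem_univ, true_and, Set.mem_union, Finset.mem_coe, Finset.mem_filter,
      Finset.mem_univ, not_or, not_exists, not_and] at hv
    exact ⟨by rintro rfl; exact hv.1 ha, hv.2 a ha⟩
  rw [fracIndepNum_eq_card_div_two]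
  · simp only [Finset.coe_sort_coe, Fintype.card_coe]
  intro S hS
  set S' := S.map (Function.Embedding.subtype _) with hS'
  have hAS : Disjoint A S' := by
    rw [Finset.disjoint_left]
    intro a ha haS
    obtain ⟨v, -, rfl⟩ := Finset.mem_map.1 haS
    exact (hdis _ ha v).1 rfl
  have hsub : finNbhd H (A ∪ S') ⊆
      finNbhd H A ∪ (finNbhd (H.induce _) S).map (Function.Embedding.subtype _) := by
    intro w hw
    obtain ⟨u, hu, huw⟩ := (Finset.mem_filter.1 hw).2
    by_cases hwA : w ∈ finNbhd H A
    · exact Finset.mem_union_left _ hwA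
    rcases Finset.mem_union.1 hu with hu | hu
    · exact Finset.mem_union_left _ (Finset.mem_filter.2 ⟨Finset.mem_univ _, u, hu, huw⟩)
    obtain ⟨v, hv, rfl⟩ := Finset.mem_map.1 hu
    have hwA' : w ∉ A := fun hw => (hdis w hw v).2 huw.symm
    refine Finset.mem_union_right _ (Finset.mem_map.2 ⟨⟨w, by simp [hwA, hwA']⟩, ?_, rfl⟩)
    exact Finset.mem_filter.2 ⟨Finset.mem_univ _, v, hv, huw⟩
  have hcard := (Finset.card_le_card hsub).trans (Finset.card_union_le _ _)
  rw [Finset.card_map] at hcard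
  have hle := hmax (A ∪ S') (by
    intro u hu v hv huv
    rcases Finset.mem_union.1 hu with hu | hu <;> rcases Finset.mem_union.1 hv with hv | hv
    · exact hA u hu v hv huv
    · obtain ⟨v, -, rfl⟩ := Finset.mem_map.1 hv
      exact (hdis u hu v).2 huv
    · obtain ⟨u, -, rfl⟩ := Finset.mem_map.1 hu
      exact (hdis v hv u).2 huv.symm
    · obtain ⟨u, hu', rfl⟩ := Finset.mem_map.1 hu
      obtain ⟨v, hv', rfl⟩ := Finset.mem_map.1 hv
      exact hS u hu' v hv' huv)
  rw [Finset.card_union_of_disjoint hAS, hS', Finset.card_map, ← hS'] at hle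
  have hcard' : ((finNbhd H (A ∪ S')).card : ℝ) ≤
      (finNbhd H A).card + (finNbhd (H.induce _) S).card := by exact_mod_cast hcard
  push_cast at hle
  have hreal : (S.card : ℝ) ≤ (finNbhd (H.induce _) S).card := by linarith
  exact_mod_cast hreal
end

section
/- Let H be a finite simple graph in which every nonempty independent set S satisfies |S| < |N(S)|. Then the fractional independence number of H equals |V(H)|/2, and for every vertex v ∈ V(H), the fractional independence number of H − v (the subgraph induced on V(H) \ {v}) equals (|V(H)| − 1)/2; in particular, H − v has no isolated vertex. -/
open SimpleGraph

/-- A graph with an injective self-map sending each vertex to a neighbour has fractional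
independence number half its order. -/
theorem fracIndepNum_eq_of_injective {V : Type*} [Fintype V] (H : SimpleGraph V) (f : V → V)
    (hf : Function.Injective f) (hadj : ∀ v, H.Adj v (f v)) :
    fracIndepNum H = (Fintype.card V : ℝ) / 2 := by
  refine IsGreatest.csSup_eq ⟨⟨fun _ => 1 / 2, ?_, ?_, ?_⟩, ?_⟩
  · intro _; norm_num
  · intro _ _ _; norm_num
  · simp [div_eq_mul_inv]
  · rintro x ⟨ω, -, hω, rfl⟩
    have hperm : ∑ v, ω (f v) = ∑ v, ω v :=
      (Finite.injective_iff_bijective.mp hf).sum_comp ω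
    have hle : ∑ v, (ω v + ω (f v)) ≤ ∑ _v : V, (1 : ℝ) :=
      Finset.sum_le_sum fun v _ => hω v (f v) (hadj v)
    rw [Finset.sum_add_distrib, hperm] at hle
    simp only [Finset.sum_const, Finset.card_univ, nsmul_eq_mul, mul_one] at hle
    linarith

/-- If independent sets strictly expand, then every vertex set `T` either expands strictly or is
contained in its neighbourhood. -/
theorem subset_finNbhd_or_card_lt {V : Type*} [Fintype V] [DecidableEq V]
    (H : SimpleGraph V) [DecidableRel H.Adj]
    (h : ∀ S : Finset V, S.Nonempty → (∀ u ∈ S, ∀ v ∈ S, ¬ H.Adj u v) →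
      S.card < (finNbhd H S).card) (T : Finset V) :
    T ⊆ finNbhd H T ∨ T.card < (finNbhd H T).card := by
  rcases (T \ finNbhd H T).eq_empty_or_nonempty with hS | hS
  · exact Or.inl (Finset.sdiff_eq_empty_iff_subset.mp hS)
  · right
    have hlt := h _ hS (by
      intro u hu v hv huv
      simp only [finNbhd, Finset.mem_sdiff, Finset.mem_filter, Finset.mem_univ, true_and] at hu hv
      exact hv.2 ⟨u, hu.1, huv⟩)
    have hdisj : Disjoint (T ∩ finNbhd H T) (finNbhd H (T \ finNbhd H T)) := by
      rw [Finset.disjoint_left]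
      intro v hv hv'
      simp only [finNbhd, Finset.mem_sdiff, Finset.mem_inter, Finset.mem_filter, Finset.mem_univ,
        true_and] at hv hv'
      obtain ⟨u, hu, huv⟩ := hv'
      exact hu.2 ⟨v, hv.1, huv.symm⟩
    have hsub : (T ∩ finNbhd H T) ∪ finNbhd H (T \ finNbhd H T) ⊆ finNbhd H T := by
      refine Finset.union_subset Finset.inter_subset_right ?_
      intro v hv
      simp only [finNbhd, Finset.mem_sdiff, Finset.mem_filter, Finset.mem_univ, true_and] at hv ⊢
      obtain ⟨u, hu, huv⟩ := hv
      exact ⟨u, hu.1, huv⟩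
    have hcard := Finset.card_le_card hsub
    rw [Finset.card_union_of_disjoint hdisj] at hcard
    have := Finset.card_sdiff_add_card_inter T (finNbhd H T)
    omega

theorem frac_indep_of_expander {V : Type*} [Fintype V] [DecidableEq V]
    (H : SimpleGraph V) [DecidableRel H.Adj]
    (h : ∀ S : Finset V, S.Nonempty → (∀ u ∈ S, ∀ v ∈ S, ¬ H.Adj u v) →
      S.card < (finNbhd H S).card) :
    fracIndepNum H = (Fintype.card V : ℝ) / 2 ∧
    ∀ v : V,
      fracIndepNum (H.induce ((Finset.univ.erase v : Finset V) : Set V)) =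
        ((Fintype.card V : ℝ) - 1) / 2 ∧
      ∀ u : ((Finset.univ.erase v : Finset V) : Set V),
        ∃ w, (H.induce ((Finset.univ.erase v : Finset V) : Set V)).Adj u w := by
  refine ⟨?_, fun v => ?_⟩
  · obtain ⟨f, hf, hadj⟩ :=
      (Fintype.all_card_le_filter_rel_iff_exists_injective H.Adj).mp fun T => by
        rcases subset_finNbhd_or_card_lt H h T with hT | hT
        · exact Finset.card_le_card hT
        · exact hT.le
    exact fracIndepNum_eq_of_injective H f hf hadj
  · obtain ⟨f, hf, hadj⟩ := (Fintype.all_card_le_filter_rel_iff_exists_injective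
      (H.induce ((Finset.univ.erase v : Finset V) : Set V)).Adj).mp fun A => by
        let T := A.map (Function.Embedding.subtype _)
        have hmap : (Finset.univ.filter fun b => ∃ a ∈ A,
            (H.induce ((Finset.univ.erase v : Finset V) : Set V)).Adj a b).map
              (Function.Embedding.subtype _) = (finNbhd H T).erase v := by
          ext w
          simp [finNbhd, T]
          tauto
        have hvT : v ∉ T := by simp [T]
        rw [← Finset.card_map (Function.Embedding.subtype _),
          ← Finset.card_map (s := Finset.filter _ _) (Function.Embedding.subtype _), hmap]
        rcases subset_finNbhd_or_card_lt H h T with hT | hT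
        · exact Finset.card_le_card (Finset.subset_erase.mpr ⟨hT, hvT⟩)
        · exact (Nat.le_sub_one_of_lt hT).trans Finset.pred_card_le_card_erase
    refine ⟨?_, fun u => ⟨f u, hadj u⟩⟩
    rw [fracIndepNum_eq_of_injective _ f hf hadj]
    have hpos : 1 ≤ Fintype.card V := Fintype.card_pos_iff.mpr ⟨v⟩
    simp [Nat.cast_sub hpos]
end
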